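/- Let i, l ≥ 2 and j, k, m, n ≥ 1 be integers. Then ∫_▲ u_{ijk}(x,y,z) b_{lmn}(x,y,z) dx dy dz = 0 whenever (i,j,k) ≠ (l,m,n), and ∫_▲ u_{ijk} b_{ijk} dx dy dz = −64/( i (2i−1) (2j+2i−1) (j+2i−1) (2k+2i+2j−1) (k+2i+2j−1) ). In particular the interior H¹ shape functions on the tetrahedron and the functions b_{lmn} form a biorthogonal system in L²(▲). -/

import Mathlib

open MeasureTheory

/-- Jacobi polynomial `P_n^{(a,b)}` via the Rodrigues formula (on `(-1,1)`). -/
noncomputable def jacobiP (n a b : ℕ) (x : ℝ) : ℝ :=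
  (1 / ((2:ℝ)^n * (Nat.factorial n : ℝ) * (1 - x)^a * (1 + x)^b)) *
    iteratedDeriv n (fun t : ℝ => (1 - t)^a * (1 + t)^b * (t^2 - 1)^n) x

/-- Legendre polynomial `L_n = P_n^{(0,0)}`. -/
noncomputable def legendreP (n : ℕ) (x : ℝ) : ℝ := jacobiP n 0 0 x

/-- Integrated Jacobi polynomial `P̂_n^a(x) = ∫_{-1}^x P_{n-1}^{(a,0)}(t) dt`. -/
noncomputable def intJacobiP (n a : ℕ) (x : ℝ) : ℝ :=
  ∫ t in (-1:ℝ)..x, jacobiP (n - 1) a 0 t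

/-- Integrated Legendre polynomial `L̂_n`. -/
noncomputable def intLegendreP (n : ℕ) (x : ℝ) : ℝ := intJacobiP n 0 x

/-- The open reference tetrahedron with vertices `(-1,-1,-1)`, `(1,-1,-1)`,
`(0,1,-1)`, `(0,0,1)`. -/
def Tet : Set (ℝ × ℝ × ℝ) :=
  {p | -1 < p.2.2 ∧ p.2.2 < 1 ∧ |p.2.1| < (1 - p.2.2) / 2 ∧
       |p.1| < (1 - 2*p.2.1 - p.2.2) / 4}

/-- Interior `H¹` shape functions on the tetrahedron. -/
noncomputable def uTet (i j k : ℕ) (p : ℝ × ℝ × ℝ) : ℝ :=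
  intLegendreP i (4*p.1 / (1 - 2*p.2.1 - p.2.2)) * ((1 - 2*p.2.1 - p.2.2) / 4)^i *
    intJacobiP j (2*i) (2*p.2.1 / (1 - p.2.2)) * ((1 - p.2.2) / 2)^j *
    intJacobiP k (2*i + 2*j) p.2.2

/-- Dual functions on the tetrahedron. -/
noncomputable def bTet (l m n : ℕ) (p : ℝ × ℝ × ℝ) : ℝ :=
  jacobiP (l-2) 1 1 (4*p.1 / (1 - 2*p.2.1 - p.2.2)) * ((1 - 2*p.2.1 - p.2.2) / 4)^(l-2) *
    jacobiP (m-1) (2*l-1) 1 (2*p.2.1 / (1 - p.2.2)) * ((1 - p.2.2) / 2)^(m-1) *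
    jacobiP (n-1) (2*l + 2*m - 1) 1 p.2.2

section Helpers
open Polynomial


noncomputable def pI (p : ℝ[X]) : ℝ := ∫ x in (-1:ℝ)..1, p.eval x

theorem pI_add (p q : ℝ[X]) : pI (p + q) = pI p + pI q := by
  unfold pI
  simp only [eval_add]
  exact intervalIntegral.integral_add (p.continuous.intervalIntegrable _ _) (q.continuous.intervalIntegrable _ _)

theorem pI_C_mul (c : ℝ) (p : ℝ[X]) : pI (C c * p) = c * pI p := by
  unfold pI
  simp only [eval_mul, eval_C]
  exact intervalIntegral.integral_const_mul _ _

theorem int_deriv (p : ℝ[X]) (a b : ℝ) : ∫ x in a..b, (derivative p).eval x = p.eval b - p.eval a :=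
  intervalIntegral.integral_eq_sub_of_hasDerivAt (fun x _ => p.hasDerivAt x)
    ((derivative p).continuous.intervalIntegrable _ _)

theorem pI_ibp (n : ℕ) : ∀ (p q : ℝ[X]), (1 - X)^n ∣ p → (1 + X)^n ∣ p →
    pI (derivative^[n] p * q) = (-1)^n * pI (p * derivative^[n] q) := by
  induction n with
  | zero => intro p q _ _; simp
  | succ n ih =>
    intro p q h1 h2
    have h1' := pow_sub_dvd_iterate_derivative_of_pow_dvd 1 h1
    have h2' := pow_sub_dvd_iterate_derivative_of_pow_dvd 1 h2
    simp only [Nat.add_sub_cancel, Function.iterate_one] at h1' h2'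
    rw [Function.iterate_succ_apply, ih _ _ h1' h2', Function.iterate_succ_apply']
    have e1 : p.eval 1 = 0 := by
      obtain ⟨r, rfl⟩ := h1; simp
    have e2 : p.eval (-1) = 0 := by
      obtain ⟨r, rfl⟩ := h2; simp
    have h := int_deriv (p * derivative^[n] q) (-1) 1
    rw [eval_mul, eval_mul, e1, e2, derivative_mul] at h
    have h3 := pI_add (derivative p * derivative^[n] q) (p * derivative (derivative^[n] q))
    have h4 : pI (derivative p * derivative^[n] q + p * derivative (derivative^[n] q)) = 0 := by
      unfold pI; rw [h]; ring
    rw [h4] at h3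
    rw [pow_succ]
    linear_combination (-(-1)^n) * h3

theorem pI_beta (b : ℕ) : ∀ a : ℕ, pI ((1 - X)^a * (1 + X)^b) * ((a+b+1).factorial : ℝ) =
    2^(a+b+1) * (a.factorial : ℝ) * (b.factorial : ℝ) := by
  induction b with
  | zero =>
    intro a
    have h := int_deriv ((1-X)^(a+1)) (-1) 1
    have h2 := pI_C_mul (-(a+1:ℝ)) ((1-X)^a)
    have h3 : derivative ((1-X:ℝ[X])^(a+1)) = C (-(a+1:ℝ)) * (1-X)^a := by
      rw [derivative_pow_succ]; simp; ring
    rw [h3] at h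
    unfold pI at h2
    rw [h] at h2
    simp at h2
    simp only [pow_zero, mul_one, add_zero, Nat.factorial_zero, Nat.cast_one, Nat.factorial_succ]
    push_cast
    unfold pI
    simp
    norm_num at h2
    have h6 : (∫ x in (-1:ℝ)..1, (1-x)^a) * (a+1) = 2^(a+1) := by linarith
    linear_combination (a.factorial:ℝ) * h6
  | succ b ih =>
    intro a
    have h := int_deriv ((1-X)^(a+1)*(1+X)^(b+1)) (-1) 1
    have h3 : derivative ((1-X:ℝ[X])^(a+1)*(1+X)^(b+1)) = C (-(a+1:ℝ)) * ((1-X)^a * (1+X)^(b+1)) +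
       C ((b+1:ℝ)) * ((1-X)^(a+1) * (1+X)^b) := by
      rw [derivative_mul, derivative_pow_succ, derivative_pow_succ]; simp; ring
    rw [h3] at h
    have h4 := pI_add (C (-(a+1:ℝ)) * ((1-X)^a * (1+X)^(b+1))) (C ((b+1:ℝ)) * ((1-X)^(a+1) * (1+X)^b))
    rw [pI_C_mul, pI_C_mul] at h4
    change pI _ = _ at h
    rw [h] at h4
    have := ih (a+1)
    rw [show a+1+b+1 = a + (b+1)+1 by ring, Nat.factorial_succ a] at this
    rw [Nat.factorial_succ b]
    have h5 : pI ((1-X)^a * (1+X)^(b+1)) * (a+1) = (b+1) * pI ((1-X)^(a+1)*(1+X)^b) := by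
      simp at h4
      linarith
    have ha : (a+1:ℝ) ≠ 0 := by positivity
    apply mul_left_cancel₀ ha
    push_cast at this ⊢
    linear_combination ((a+(b+1)+1).factorial:ℝ) * h5 + (b+1:ℝ) * this

theorem exists_J (n a b : ℕ) : ∃ J : ℝ[X], J.natDegree ≤ n ∧
    C ((-2)^n * (n.factorial:ℝ)) * ((1-X)^a*(1+X)^b*J) = derivative^[n] ((1-X)^(a+n)*(1+X)^(b+n)) ∧
    J.coeff n * (2^n * n.factorial * (n+a+b).factorial) = ((2*n+a+b).factorial : ℝ) := by
  have hc : ((-2)^n * (n.factorial:ℝ)) ≠ 0 := by positivity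
  have d1 : ((1-X:ℝ[X])^a) ∣ derivative^[n] ((1-X:ℝ[X])^(a+n)*(1+X)^(b+n)) := by
    have := pow_sub_dvd_iterate_derivative_of_pow_dvd n (Dvd.intro _ rfl : (1-X:ℝ[X])^(a+n) ∣ (1-X:ℝ[X])^(a+n)*(1+X)^(b+n))
    simpa using this
  have d2 : ((1+X:ℝ[X])^b) ∣ derivative^[n] ((1-X:ℝ[X])^(a+n)*(1+X)^(b+n)) := by
    have := pow_sub_dvd_iterate_derivative_of_pow_dvd n (Dvd.intro_left _ rfl : (1+X:ℝ[X])^(b+n) ∣ (1-X:ℝ[X])^(a+n)*(1+X)^(b+n))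
    simpa using this
  have hcop : IsCoprime (1-X:ℝ[X]) (1+X) := by
    refine ⟨C (1/2), C (1/2), ?_⟩
    rw [← mul_add, show (1-X+(1+X):ℝ[X]) = C 2 by rw [show (C 2 : ℝ[X]) = 2 from rfl]; ring, ← C_mul]; norm_num
  obtain ⟨K, hK⟩ := (hcop.pow (m := a) (n := b)).mul_dvd d1 d2
  have hA1 : (1-X:ℝ[X]).natDegree ≤ 1 := by compute_degree
  have hB1 : (1+X:ℝ[X]).natDegree ≤ 1 := by compute_degree
  have hA (k:ℕ) : ((1-X:ℝ[X])^k).natDegree ≤ k := by simpa using natDegree_pow_le_of_le k hA1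
  have hB (k:ℕ) : ((1+X:ℝ[X])^k).natDegree ≤ k := by simpa using natDegree_pow_le_of_le k hB1
  have cA (k:ℕ) : ((1-X:ℝ[X])^k).coeff k = (-1)^k := by
    have := coeff_pow_of_natDegree_le (m := k) hA1
    simpa [coeff_one] using this
  have cB (k:ℕ) : ((1+X:ℝ[X])^k).coeff k = 1 := by
    have := coeff_pow_of_natDegree_le (m := k) hB1
    simpa [coeff_one] using this
  have cM (k l:ℕ) : ((1-X:ℝ[X])^k*(1+X)^l).coeff (k+l) = (-1)^k := by
    rw [coeff_mul_add_eq_of_natDegree_le (hA k) (hB l), cA, cB, mul_one]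
  have dM (k l:ℕ) : ((1-X:ℝ[X])^k*(1+X)^l).natDegree ≤ (k+l) := natDegree_mul_le_of_le (hA k) (hB l)
  have dM' (k l:ℕ) : ((1-X:ℝ[X])^k*(1+X)^l).natDegree = (k+l) := 
    natDegree_eq_of_le_of_coeff_ne_zero (dM k l) (by rw [cM]; simp)
  have hKd : K.natDegree ≤ n := by
    by_cases h0 : K = 0
    · simp [h0]
    have h1 : ((1-X:ℝ[X])^a*(1+X)^b) ≠ 0 := by
      intro h; have := cM a b; rw [h] at this; simp at this
      exact absurd this.symm (by simp)
    have h2 := natDegree_mul h1 h0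
    rw [← hK, dM'] at h2
    have h3 := natDegree_iterate_derivative ((1-X:ℝ[X])^(a+n)*(1+X)^(b+n)) n
    rw [dM'] at h3
    omega
  have hKc : (-1)^a * K.coeff n * ((n+a+b).factorial) = (-1)^(a+n) * ((2*n+a+b).factorial : ℝ) := by
    have h := congrArg (fun p => coeff p (a+b+n)) hK
    rw [coeff_mul_add_eq_of_natDegree_le (dM a b) hKd, cM, coeff_iterate_derivative, 
      show a+b+n+n = (a+n)+(b+n) by ring, cM] at h
    rw [← h, show (a+n)+(b+n) = 2*n+a+b by ring]
    have := Nat.factorial_mul_descFactorial (show n ≤ 2*n+a+b by omega)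
    rw [show 2*n+a+b-n = n+a+b by omega] at this
    rw [← this]; push_cast; simp; ring
  refine ⟨C (((-2)^n * (n.factorial:ℝ))⁻¹) * K, ?_, ?_, ?_⟩
  · exact (natDegree_C_mul_le _ _).trans hKd
  · rw [hK]
    have : C ((-2)^n * (n.factorial:ℝ)) * C (((-2)^n * (n.factorial:ℝ))⁻¹) = 1 := by
      rw [← C_mul, mul_inv_cancel₀ hc, C_1]
    linear_combination ((1-X)^a*(1+X)^b*K) * this
  · rw [coeff_C_mul]
    have h1 : ((-1:ℝ)^a)*(-1)^a = 1 := by rw [← mul_pow]; simp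
    have h2 : ((-1:ℝ)^n)*(-1)^n = 1 := by rw [← mul_pow]; simp
    have h5 : (-2:ℝ)^n = (-1)^n*2^n := by rw [← mul_pow]; norm_num
    have h6 : K.coeff n * ((n+a+b).factorial) = (-1)^n * ((2*n+a+b).factorial : ℝ) := by
      rw [pow_add] at hKc
      linear_combination (-1)^a * hKc + ((-1)^n * ((2*n+a+b).factorial : ℝ) - K.coeff n * ((n+a+b).factorial) ) * h1
    have h7 : (n.factorial:ℝ) ≠ 0 := by positivity
    rw [h5]
    field_simp
    linear_combination h6

noncomputable def jP (n a b : ℕ) : ℝ[X] := Classical.choose (exists_J n a b)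

theorem jP_deg (n a b : ℕ) : (jP n a b).natDegree ≤ n := (Classical.choose_spec (exists_J n a b)).1
theorem jP_rod (n a b : ℕ) : C ((-2)^n * (n.factorial:ℝ)) * ((1-X)^a*(1+X)^b*jP n a b) =
    derivative^[n] ((1-X)^(a+n)*(1+X)^(b+n)) := (Classical.choose_spec (exists_J n a b)).2.1
theorem jP_coeff (n a b : ℕ) : (jP n a b).coeff n * (2^n * n.factorial * (n+a+b).factorial) =
    ((2*n+a+b).factorial : ℝ) := (Classical.choose_spec (exists_J n a b)).2.2

theorem iterD (n : ℕ) : ∀ (p : ℝ[X]) (x : ℝ),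
    iteratedDeriv n (fun t => p.eval t) x = (derivative^[n] p).eval x := by
  induction n with
  | zero => intro p x; simp
  | succ n ih =>
    intro p x
    rw [iteratedDeriv_succ', Function.iterate_succ_apply, ← ih]
    congr 1
    funext t
    exact p.deriv

theorem jacobiP_eq (n a b : ℕ) (x : ℝ) (hx : (1-x)^a*(1+x)^b ≠ 0) :
    jacobiP n a b x = (jP n a b).eval x := by
  unfold jacobiP
  have h1 : (fun t : ℝ => (1 - t)^a * (1 + t)^b * (t^2 - 1)^n) =
      fun t => (C ((-1)^n) * ((1-X)^(a+n)*(1+X)^(b+n)) : ℝ[X]).eval t := by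
    funext t
    simp only [eval_mul, eval_C, eval_pow, eval_sub, eval_add, eval_one, eval_X]
    rw [show t^2-1 = (-1)*((1-t)*(1+t)) by ring, mul_pow, mul_pow]; ring
  rw [h1, iterD, iterate_derivative_C_mul, ← jP_rod]
  simp only [eval_mul, eval_C, eval_pow, eval_sub, eval_add, eval_one, eval_X]
  have h5 : (-2:ℝ)^n = (-1)^n*2^n := by rw [← mul_pow]; norm_num
  have h2 : ((-1:ℝ)^n)*(-1)^n = 1 := by rw [← mul_pow]; simp
  have h7 : (n.factorial:ℝ) ≠ 0 := by positivity
  have h8 : (2:ℝ)^n ≠ 0 := by positivity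
  have h9 := left_ne_zero_of_mul hx
  have h10 := right_ne_zero_of_mul hx
  rw [h5]
  field_simp
  linear_combination (eval x (jP n a b)) * h2

theorem pI_orth (n a b : ℕ) (q : ℝ[X]) (hq : q.natDegree ≤ n) :
    pI ((1-X)^a*(1+X)^b*jP n a b * q) * 2^n = q.coeff n * pI ((1-X)^(a+n)*(1+X)^(b+n)) := by
  have h1 := pI_ibp n ((1-X)^(a+n)*(1+X)^(b+n)) q ((pow_dvd_pow _ (by omega)).trans (Dvd.intro _ rfl))
    ((pow_dvd_pow _ (by omega)).trans (Dvd.intro_left _ rfl))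
  have h2 : derivative^[n] q = C (n.factorial * q.coeff n) := by
    have h3 : (derivative^[n] q).natDegree ≤ 0 := by
      have := natDegree_iterate_derivative q n; omega
    rw [eq_C_of_natDegree_le_zero h3, coeff_iterate_derivative]
    simp [Nat.descFactorial_self]
  rw [← jP_rod, h2, mul_comm _ (C ((n.factorial:ℝ) * _)), pI_C_mul, mul_assoc, pI_C_mul] at h1
  have h5 : (-2:ℝ)^n = (-1)^n*2^n := by rw [← mul_pow]; norm_num
  have h7 : ((-1)^n * (n.factorial:ℝ)) ≠ 0 := by positivity
  rw [h5] at h1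
  apply mul_left_cancel₀ h7
  linear_combination h1

theorem pI_orth0 (n m a b : ℕ) (h : n ≠ m) : pI ((1-X)^a*(1+X)^b*jP n a b * jP m a b) = 0 := by
  have key : ∀ n m : ℕ, m < n → pI ((1-X)^a*(1+X)^b*jP n a b * jP m a b) = 0 := by
    intro n m h
    have h1 := pI_orth n a b (jP m a b) ((jP_deg m a b).trans h.le)
    rw [coeff_eq_zero_of_natDegree_lt ((jP_deg m a b).trans_lt h), zero_mul] at h1
    exact (mul_eq_zero.1 h1).resolve_right (by positivity)
  rcases lt_or_gt_of_ne h with h | h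
  · rw [mul_right_comm]; exact key _ _ h
  · exact key _ _ h

theorem pI_norm (n a b : ℕ) : pI ((1-X)^a*(1+X)^b*jP n a b * jP n a b) *
    ((2*n+a+b+1) * n.factorial * (n+a+b).factorial) = 2^(a+b+1)*(a+n).factorial * (b+n).factorial := by
  have h1 := pI_orth n a b (jP n a b) (jP_deg n a b)
  have h2 := jP_coeff n a b
  have h3 := pI_beta (b+n) (a+n)
  rw [show a+n+(b+n)+1 = (2*n+a+b)+1 by ring, Nat.factorial_succ] at h3
  push_cast at h3
  have h4 : ((2*n+a+b).factorial : ℝ) ≠ 0 := by positivity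
  have h8 : (2:ℝ)^n ≠ 0 := by positivity
  apply mul_left_cancel₀ (mul_ne_zero (mul_ne_zero h8 h8) h4)
  set Q := pI ((1-X)^a*(1+X)^b*jP n a b * jP n a b)
  set B := pI ((1-X)^(a+n)*(1+X)^(b+n))
  rw [show 2*n+a+b+1 = n+n+(a+b+1) by ring, pow_add, pow_add] at h3
  linear_combination 2^n * (2*n+a+b).factorial * (2*n+a+b+1) * n.factorial * (n+a+b).factorial * h1
   + (2*n+a+b).factorial * (2*n+a+b+1) * B * h2 + (2*n+a+b).factorial * h3

noncomputable def PH (N A : ℕ) : ℝ[X] := C (1/((N:ℝ)+1)) * ((1+X) * jP N A 1)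

theorem oneSub_deriv (k : ℕ) : (1-X:ℝ[X]) * derivative ((1-X)^k) = - (k:ℝ[X]) * (1-X)^k := by
  cases k with
  | zero => simp
  | succ k => rw [derivative_pow_succ]; simp; ring

theorem iter_oneSub (n : ℕ) : ∀ F : ℝ[X], derivative^[n+1] ((1-X) * F) =
    (1-X) * derivative^[n+1] F - ((n:ℝ[X])+1) * derivative^[n] F := by
  induction n with
  | zero => intro F; simp; ring
  | succ n ih =>
    intro F
    rw [Function.iterate_succ_apply', ih, derivative_sub, derivative_mul, derivative_mul]
    rw [← Function.iterate_succ_apply' derivative (n+1) F, ← Function.iterate_succ_apply' derivative n F]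
    simp
    ring

theorem deriv_PH (n a : ℕ) : derivative (PH n a) = jP n (a+1) 0 := by
  have h1 := jP_rod n a 1
  have h2 := jP_rod n (a+1) 0
  set F : ℝ[X] := (1-X)^(a+n)*(1+X)^(1+n) with hF
  set G := (1+X) * jP n a 1 with hG
  have h3 := iter_oneSub n F
  have h1' := congrArg derivative h1
  rw [← Function.iterate_succ_apply' derivative n F] at h1'
  have h4 : derivative ((1-X)*F) + ((n:ℝ[X])+(a:ℝ[X])+1)*F = ((n:ℝ[X])+1)*((1-X)^(a+1+n)*(1+X)^(0+n)) := by
    have e : (1-X)*F = (1-X)^(a+n+1)*(1+X)^(n+1) := by rw [hF]; ring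
    rw [e, derivative_mul, derivative_pow_succ, derivative_pow_succ, hF]
    simp
    ring
  have h5 := congrArg (fun p => derivative^[n] p) h4
  rw [iterate_map_add] at h5
  rw [show (n:ℝ[X])+(a:ℝ[X])+1 = C ((n:ℝ)+a+1) by simp, show (n:ℝ[X])+1 = C ((n:ℝ)+1) by simp,
   iterate_derivative_C_mul, iterate_derivative_C_mul, ← h2, ← Function.iterate_succ_apply, h3, ← h1] at h5
  have h6 := oneSub_deriv a
  rw [show (1-X)^a*(1+X)^1*jP n a 1 = (1-X)^a*G by rw [hG]; ring] at h1' h5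
  rw [derivative_C_mul, derivative_mul] at h1'
  rw [← h1'] at h5
  have hc : C ((-2)^n * (n.factorial:ℝ)) ≠ 0 := by
    rw [Ne, C_eq_zero]; positivity
  have hX : (1-X:ℝ[X]) ≠ 0 := by
    intro h; have := congrArg (eval 0) h; simp at this
  have h7 : derivative G = C ((n:ℝ)+1) * jP n (a+1) 0 := by
    apply mul_left_cancel₀ (mul_ne_zero hc (pow_ne_zero (a+1) hX))
    simp only [C_add, C_1, pow_zero, mul_one, map_natCast, C_mul] at h5 h6 ⊢
    linear_combination h5 - C ((-2)^n) * (n.factorial : ℝ[X]) * G * h6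
  rw [PH, ← hG, derivative_C_mul, h7, ← mul_assoc, ← C_mul, one_div_mul_cancel (by positivity), C_1, one_mul]

noncomputable def LH (N : ℕ) : ℝ[X] := C (-1/(2*((N:ℝ)+1))) * ((1-X)*(1+X) * jP N 1 1)

theorem deriv_LH (n : ℕ) : derivative (LH n) = jP (n+1) 0 0 := by
  have h1 := jP_rod n 1 1
  have h2 := jP_rod (n+1) 0 0
  rw [show 0+(n+1) = 1+n by ring, Function.iterate_succ_apply', ← h1, derivative_C_mul] at h2
  have hc : (((-2)^(n+1) * ((n+1).factorial:ℝ))) ≠ 0 := by positivity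
  apply mul_left_cancel₀ (C_ne_zero.2 hc)
  rw [LH, derivative_C_mul, ← mul_assoc, ← C_mul]
  simp only [pow_zero, one_mul, pow_one] at h2
  rw [h2, Nat.factorial_succ]
  congr 2
  push_cast
  field_simp
  ring

theorem intJ_eq (N A : ℕ) (x : ℝ) (hx : x ∈ Set.Ioo (-1:ℝ) 1) :
    intJacobiP (N+1) (A+1) x = (PH N A).eval x := by
  unfold intJacobiP
  rw [intervalIntegral.integral_congr (g := fun t => (derivative (PH N A)).eval t), int_deriv]
  · simp [PH]
  · intro t ht
    rw [Set.uIcc_of_le hx.1.le] at ht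
    simp only [Nat.add_sub_cancel]
    rw [deriv_PH, jacobiP_eq]
    have : 0 < 1 - t := by linarith [ht.2, hx.2]
    positivity

theorem intL_eq (N : ℕ) (x : ℝ) :
    intLegendreP (N+2) x = (LH N).eval x := by
  unfold intLegendreP intJacobiP
  rw [intervalIntegral.integral_congr (g := fun t => (derivative (LH N)).eval t), int_deriv]
  · simp [LH]
  · intro t ht
    change jacobiP (N+1) 0 0 t = _
    rw [deriv_LH, jacobiP_eq]
    simp

theorem valA0 (I L : ℕ) (h : I ≠ L) : pI (LH I * jP L 1 1) = 0 := by
  have := pI_orth0 I L 1 1 h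
  rw [LH, mul_assoc, pI_C_mul, mul_eq_zero]; right
  simpa using this

theorem valA (I : ℕ) : pI (LH I * jP I 1 1) = -4 / (((I+2:ℕ):ℝ) * (2*((I+2:ℕ):ℝ)-1)) := by
  have := pI_norm I 1 1
  rw [LH, mul_assoc, pI_C_mul]
  simp only [pow_one] at this
  rw [show I+1+1 = (I+1)+1 by ring, Nat.factorial_succ (I+1), add_comm 1 I, Nat.factorial_succ] at this
  set Q := pI ((1 - X) * (1 + X) * jP I 1 1 * jP I 1 1)
  have h7 : (I.factorial:ℝ) ≠ 0 := by positivity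
  push_cast at this ⊢
  have h3 : Q * ((2*I+3) * (I+2)) = 8 * (I+1) := by
    apply mul_left_cancel₀ (mul_ne_zero (mul_ne_zero h7 h7) (show ((I:ℝ)+1) ≠ 0 by positivity))
    linear_combination this
  have : (2*((I:ℝ)+2)-1) ≠ 0 := by
    have : (0:ℝ) ≤ I := by positivity
    linarith
  field_simp
  linear_combination -h3

noncomputable def hw (A : ℕ) : ℝ[X] := (C (1/2) * (1-X))^A

theorem valB_aux (N M A : ℕ) : pI (hw A * PH N A * jP M A 1) =
    (1/2)^A * (1/((N:ℝ)+1)) * pI ((1-X)^A*(1+X)^1*jP N A 1 * jP M A 1) := by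
  rw [← pI_C_mul]
  congr 1
  simp only [hw, PH, C_mul, C_pow, mul_pow]
  ring

theorem valB0 (N M A : ℕ) (h : N ≠ M) : pI (hw A * PH N A * jP M A 1) = 0 := by
  rw [valB_aux, pI_orth0 _ _ _ _ h, mul_zero]

theorem valB (N A : ℕ) : pI (hw A * PH N A * jP N A 1) =
    4 / ((2*N+A+2)*(N+A+1)) := by
  rw [valB_aux]
  have := pI_norm N A 1
  set Q := pI ((1-X)^A*(1+X)^1*jP N A 1 * jP N A 1)
  rw [Nat.factorial_succ (N+A), add_comm 1 N, Nat.factorial_succ N, add_comm A N] at this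
  have h7 : (N.factorial:ℝ) ≠ 0 := by positivity
  have h8 : ((N+A).factorial:ℝ) ≠ 0 := by positivity
  push_cast at this
  have h3 : Q * ((2*N+A+2)*(N+A+1)) = 2^A * 4 * (N+1) := by
    apply mul_left_cancel₀ (mul_ne_zero h7 h8)
    rw [pow_succ, pow_succ] at this
    linear_combination this
  rw [one_div_pow]
  field_simp
  linear_combination h3

theorem duffy {W : Type*} [MeasureSpace W] [SFinite (volume : Measure W)] (S : Set W)
    (hS : MeasurableSet S) (s : W → ℝ) (hs : Measurable s) (hpos : ∀ w ∈ S, 0 < s w)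
    (φ : ℝ → ℝ) (ψ : W → ℝ)
    (hint : IntegrableOn (fun p : ℝ × W => φ (p.1 / s p.2) * ψ p.2) {p : ℝ × W | p.2 ∈ S ∧ |p.1| < s p.2}) :
    ∫ p in {p : ℝ × W | p.2 ∈ S ∧ |p.1| < s p.2}, φ (p.1 / s p.2) * ψ p.2 =
      (∫ x in (-1:ℝ)..1, φ x) * ∫ w in S, s w * ψ w := by
  have hD : MeasurableSet {p : ℝ × W | p.2 ∈ S ∧ |p.1| < s p.2} := by
    apply MeasurableSet.inter
    · exact measurable_snd hS
    · exact measurableSet_lt (f := fun p : ℝ × W => |p.1|) (g := fun p : ℝ × W => s p.2) (by fun_prop) (by fun_prop)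
  rw [← integral_indicator hD, Measure.volume_eq_prod, integral_prod_symm]
  · rw [← integral_indicator hS, ← integral_const_mul]
    congr 1
    funext w
    by_cases hw : w ∈ S
    · have hp := hpos w hw
      rw [Set.indicator_of_mem hw]
      have : (fun x : ℝ => Set.indicator {p : ℝ × W | p.2 ∈ S ∧ |p.1| < s p.2}
          (fun p : ℝ × W => φ (p.1 / s p.2) * ψ p.2) (x, w)) =
          Set.indicator (Set.Ioo (-s w) (s w)) (fun x => φ (x / s w) * ψ w) := by
        funext x
        simp only [Set.indicator, Set.mem_ofPred_eq, hw, true_and, abs_lt, Set.mem_Ioo]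
      rw [this, integral_indicator measurableSet_Ioo, ← integral_Ioc_eq_integral_Ioo,
        ← intervalIntegral.integral_of_le (by linarith), intervalIntegral.integral_mul_const,
        intervalIntegral.integral_comp_div _ hp.ne', neg_div, div_self hp.ne', smul_eq_mul]
      ring
    · rw [Set.indicator_of_notMem hw]
      have : (fun x : ℝ => Set.indicator {p : ℝ × W | p.2 ∈ S ∧ |p.1| < s p.2}
          (fun p : ℝ × W => φ (p.1 / s p.2) * ψ p.2) (x, w)) = fun _ => 0 := by
        funext x
        simp [Set.indicator, hw]
      rw [this]; simp
  · rw [← Measure.volume_eq_prod]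
    exact (integrable_indicator_iff hD).2 hint

theorem poly_bd (p : ℝ[X]) : ∃ M : ℝ, 0 ≤ M ∧ ∀ x : ℝ, |x| ≤ 1 → |p.eval x| ≤ M := by
  obtain ⟨M, hM⟩ := (isCompact_Icc (a := (-1:ℝ)) (b := 1)).exists_bound_of_continuousOn
    (f := fun x => p.eval x) p.continuous.continuousOn
  refine ⟨M, (norm_nonneg _).trans (hM 0 (by simp)), fun x hx => hM x (abs_le.1 hx)⟩

theorem abs_div_le_one' (x s : ℝ) (hs : |x| < s) : |x / s| ≤ 1 := by
  have : 0 < s := (abs_nonneg x).trans_lt hs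
  rw [abs_div, abs_of_pos this, div_le_one this]; exact hs.le

def S2 : Set (ℝ × ℝ) := {w | w.2 ∈ Set.Ioo (-1:ℝ) 1 ∧ |w.1| < (1 - w.2)/2}

theorem S2_facts (w : ℝ × ℝ) (hw : w ∈ S2) : 0 < (1 - w.2)/2 ∧ (1-w.2)/2 < 1 ∧
    0 < (1 - 2*w.1 - w.2)/4 ∧ (1 - 2*w.1 - w.2)/4 < 1 := by
  obtain ⟨⟨h1, h2⟩, h3⟩ := hw
  rw [abs_lt] at h3
  refine ⟨by linarith, by linarith, by linarith, by linarith⟩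

theorem S2_meas : MeasurableSet S2 := by
  apply MeasurableSet.inter
  · exact measurable_snd measurableSet_Ioo
  · exact measurableSet_lt (f := fun p : ℝ × ℝ => |p.1|) (g := fun p : ℝ × ℝ => (1 - p.2)/2) (by fun_prop) (by fun_prop)

theorem Tet_eq : Tet = {p : ℝ × ℝ × ℝ | p.2 ∈ S2 ∧ |p.1| < (1 - 2*p.2.1 - p.2.2)/4} := by
  ext p
  simp only [Tet, S2, Set.mem_ofPred_eq, Set.mem_Ioo]
  tauto

theorem Tet_meas : MeasurableSet Tet := by
  rw [Tet_eq]
  apply MeasurableSet.inter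
  · exact measurable_snd S2_meas
  · exact measurableSet_lt (f := fun p : ℝ × ℝ × ℝ => |p.1|) (g := fun p : ℝ × ℝ × ℝ => (1 - 2*p.2.1 - p.2.2)/4) (by fun_prop) (by fun_prop)

theorem Tet_fin : volume Tet ≠ ⊤ := by
  have : Tet ⊆ Set.Icc ((-1,-1,-1) : ℝ × ℝ × ℝ) (1,1,1) := by
    rw [Tet_eq]
    rintro ⟨x, y, z⟩ ⟨h1, h2⟩
    have h3 := S2_facts _ h1
    obtain ⟨⟨h4, h5⟩, h6⟩ := h1
    simp only [abs_lt] at *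
    simp only [Set.mem_Icc, Prod.mk_le_mk]
    refine ⟨⟨?_, ?_, ?_⟩, ?_, ?_, ?_⟩ <;> linarith
  exact ((measure_mono this).trans_lt isCompact_Icc.measure_lt_top).ne

theorem S2_fin : volume S2 ≠ ⊤ := by
  have : S2 ⊆ Set.Icc ((-1,-1) : ℝ × ℝ) (1,1) := by
    rintro ⟨y, z⟩ h1
    have h3 := S2_facts _ h1
    obtain ⟨⟨h4, h5⟩, h6⟩ := h1
    simp only [abs_lt] at *
    simp only [Set.mem_Icc, Prod.mk_le_mk]
    refine ⟨⟨?_, ?_⟩, ?_, ?_⟩ <;> linarith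
  exact ((measure_mono this).trans_lt isCompact_Icc.measure_lt_top).ne

theorem pmeas (p : ℝ[X]) : Measurable fun x : ℝ => p.eval x := p.continuous.measurable

theorem int2 (p q : ℝ[X]) (e : ℕ) :
    ∫ w in S2, p.eval (w.1 / ((1-w.2)/2)) * (((1-w.2)/2)^e * q.eval w.2) =
      pI p * pI (hw (e+1) * q) := by
  have h := duffy (Set.Ioo (-1:ℝ) 1) measurableSet_Ioo (fun z => (1-z)/2) (by fun_prop)
    (fun z hz => by linarith [hz.2]) (fun x => p.eval x) (fun z => ((1-z)/2)^e * q.eval z) ?_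
  · refine h.trans ?_
    rw [← integral_Ioc_eq_integral_Ioo, ← intervalIntegral.integral_of_le (by norm_num)]
    unfold pI hw
    congr 1
    congr 1
    funext z
    simp only [eval_mul, eval_C, eval_pow, eval_sub, eval_one, eval_X]
    ring
  · obtain ⟨P, hP0, hP⟩ := poly_bd p
    obtain ⟨Q, hQ0, hQ⟩ := poly_bd q
    refine Measure.integrableOn_of_bounded (M := P * (1 * Q)) S2_fin ?_ ?_
    · have := pmeas p
      have := pmeas q
      exact Measurable.aestronglyMeasurable (by fun_prop)
    · refine (ae_restrict_iff' S2_meas).2 (Filter.Eventually.of_forall fun w hw => ?_)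
      have h3 := S2_facts _ hw
      obtain ⟨⟨h4, h5⟩, h6⟩ := hw
      rw [norm_mul, norm_mul]
      refine mul_le_mul (hP _ (abs_div_le_one' _ _ h6)) (mul_le_mul ?_ (hQ _ (abs_le.2 ⟨h4.le, h5.le⟩))
        (norm_nonneg _) zero_le_one) (by positivity) hP0
      rw [norm_pow, Real.norm_eq_abs, abs_of_pos h3.1]
      exact pow_le_one₀ h3.1.le h3.2.1.le

theorem int3 (p q r : ℝ[X]) (d e : ℕ) :
    ∫ v in Tet, p.eval (v.1 / ((1-2*v.2.1-v.2.2)/4)) * (((1-2*v.2.1-v.2.2)/4)^d *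
        q.eval (v.2.1 / ((1-v.2.2)/2)) * (((1-v.2.2)/2)^e * r.eval v.2.2)) =
      pI p * (pI (hw (d+1) * q) * pI (hw (d+1+e+1) * r)) := by
  have h := duffy S2 S2_meas (fun w => (1-2*w.1-w.2)/4) (by fun_prop)
    (fun w hw => (S2_facts w hw).2.2.1) (fun x => p.eval x) (fun w => (((1-2*w.1-w.2)/4)^d *
        q.eval (w.1 / ((1-w.2)/2)) * (((1-w.2)/2)^e * r.eval w.2))) ?_
  · rw [← Tet_eq] at h
    refine h.trans ?_
    rw [← int2]
    unfold pI
    congr 1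
    apply setIntegral_congr_fun S2_meas
    intro w hw
    have h3 := S2_facts _ hw
    simp only [_root_.hw, eval_mul, eval_C, eval_pow, eval_sub, eval_one, eval_X]
    have h4 : (1-2*w.1-w.2)/4 = ((1-w.2)/2) * (1/2 * (1 - w.1/((1-w.2)/2))) := by
      have := h3.1.ne'
      have h5 : 1 - w.2 ≠ 0 := by intro h; rw [h] at this; simp at this
      field_simp
      ring
    rw [h4]
    generalize w.1/((1-w.2)/2) = c
    generalize (1-w.2)/2 = t
    generalize 1/2 * (1-c) = u
    ring
  · rw [← Tet_eq]
    obtain ⟨P, hP0, hP⟩ := poly_bd p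
    obtain ⟨Q, hQ0, hQ⟩ := poly_bd q
    obtain ⟨R, hR0, hR⟩ := poly_bd r
    refine Measure.integrableOn_of_bounded (M := P * (1 * Q * (1 * R))) Tet_fin ?_ ?_
    · have := pmeas p
      have := pmeas q
      have := pmeas r
      exact Measurable.aestronglyMeasurable (by fun_prop)
    · refine (ae_restrict_iff' Tet_meas).2 (Filter.Eventually.of_forall fun v hv => ?_)
      rw [Tet_eq] at hv
      obtain ⟨hw, h7⟩ := hv
      have h3 := S2_facts _ hw
      obtain ⟨⟨h4, h5⟩, h6⟩ := hw
      simp only [norm_mul]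
      have b1 : ‖((1-2*v.2.1-v.2.2)/4)^d‖ ≤ 1 := by
        rw [norm_pow, Real.norm_eq_abs, abs_of_pos h3.2.2.1]
        exact pow_le_one₀ h3.2.2.1.le h3.2.2.2.le
      have b2 : ‖((1-v.2.2)/2)^e‖ ≤ 1 := by
        rw [norm_pow, Real.norm_eq_abs, abs_of_pos h3.1]
        exact pow_le_one₀ h3.1.le h3.2.1.le
      have b3 := hP _ (abs_div_le_one' _ _ h7)
      have b4 := hQ _ (abs_div_le_one' _ _ h6)
      have b5 := hR _ (abs_le.2 ⟨h4.le, h5.le⟩)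
      rw [← Real.norm_eq_abs] at b3 b4 b5
      gcongr

theorem jac_in (n a b : ℕ) (x : ℝ) (hx : |x| < 1) : jacobiP n a b x = (jP n a b).eval x := by
  apply jacobiP_eq
  rw [abs_lt] at hx
  have h1 : 0 < 1 - x := by linarith
  have h2 : 0 < 1 + x := by linarith
  positivity

theorem main_int (I J K L M N : ℕ) :
    ∫ p in Tet, uTet (I+2) (J+1) (K+1) p * bTet (L+2) (M+1) (N+1) p =
      pI (LH I * jP L 1 1) * (pI (hw (I+L+3) * (PH J (2*I+3) * jP M (2*L+3) 1)) *
        pI (hw (I+L+J+M+5) * (PH K (2*I+2*J+5) * jP N (2*L+2*M+5) 1))) := by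
  have h := int3 (LH I * jP L 1 1) (PH J (2*I+3) * jP M (2*L+3) 1)
    (PH K (2*I+2*J+5) * jP N (2*L+2*M+5) 1) (I+L+2) (J+M+1)
  rw [show I+L+2+1+(J+M+1)+1 = I+L+J+M+5 by ring] at h
  refine Eq.trans ?_ h
  apply setIntegral_congr_fun Tet_meas
  intro v hv
  rw [Tet_eq] at hv
  obtain ⟨hw, h7⟩ := hv
  have h3 := S2_facts _ hw
  obtain ⟨⟨h4, h5⟩, h6⟩ := hw
  have e1 : 4*v.1/(1-2*v.2.1-v.2.2) = v.1/((1-2*v.2.1-v.2.2)/4) := by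
    rw [div_div_eq_mul_div, mul_comm]
  have e2 : 2*v.2.1/(1-v.2.2) = v.2.1/((1-v.2.2)/2) := by
    rw [div_div_eq_mul_div, mul_comm]
  have lt1 : |v.1/((1-2*v.2.1-v.2.2)/4)| < 1 := by
    rw [abs_div, abs_of_pos h3.2.2.1, div_lt_one h3.2.2.1]; exact h7
  have lt2 : |v.2.1/((1-v.2.2)/2)| < 1 := by
    rw [abs_div, abs_of_pos h3.1, div_lt_one h3.1]; exact h6
  have lt3 : |v.2.2| < 1 := abs_lt.2 ⟨h4, h5⟩
  simp only [uTet, bTet]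
  rw [e1, e2, show L+2-2 = L by omega, show M+1-1 = M by omega, show N+1-1=N by omega,
    show 2*(L+2)-1 = 2*L+3 by omega, show 2*(L+2)+2*(M+1)-1 = 2*L+2*M+5 by omega,
    show 2*(I+2) = (2*I+3)+1 by ring, show 2*I+3+1+2*(J+1) = (2*I+2*J+5)+1 by ring,
    intL_eq, intJ_eq _ _ _ (abs_lt.1 lt2), intJ_eq _ _ _ (abs_lt.1 lt3),
    jac_in _ _ _ _ lt1, jac_in _ _ _ _ lt2, jac_in _ _ _ _ lt3]
  simp only [eval_mul]
  ring

end Helpers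

/-- Biorthogonality of the interior `H¹` shape functions and the dual functions
on the tetrahedron, together with the diagonal value. -/
theorem tetrahedron_H1_biorthogonal (i j k l m n : ℕ) (hi : 2 ≤ i) (hl : 2 ≤ l)
    (hj : 1 ≤ j) (hk : 1 ≤ k) (hm : 1 ≤ m) (hn : 1 ≤ n) :
    ((i, j, k) ≠ (l, m, n) → ∫ p in Tet, uTet i j k p * bTet l m n p = 0) ∧
    ∫ p in Tet, uTet i j k p * bTet i j k p =
      -64 / ((i:ℝ) * (2*(i:ℝ) - 1) * (2*(j:ℝ) + 2*(i:ℝ) - 1) * ((j:ℝ) + 2*(i:ℝ) - 1) *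
        (2*(k:ℝ) + 2*(i:ℝ) + 2*(j:ℝ) - 1) * ((k:ℝ) + 2*(i:ℝ) + 2*(j:ℝ) - 1)) := by
  obtain ⟨I, rfl⟩ := Nat.exists_eq_add_of_le' hi
  obtain ⟨L, rfl⟩ := Nat.exists_eq_add_of_le' hl
  obtain ⟨J, rfl⟩ := Nat.exists_eq_add_of_le' hj
  obtain ⟨K, rfl⟩ := Nat.exists_eq_add_of_le' hk
  obtain ⟨M, rfl⟩ := Nat.exists_eq_add_of_le' hm
  obtain ⟨N, rfl⟩ := Nat.exists_eq_add_of_le' hn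
  refine ⟨fun hne => ?_, ?_⟩
  · rw [main_int]
    by_cases h1 : I = L
    · subst h1
      by_cases h2 : J = M
      · subst h2
        have h3 : K ≠ N := by
          rintro rfl; exact hne rfl
        rw [show I+I+J+J+5 = 2*I+2*J+5 by ring, ← mul_assoc (hw (2*I+2*J+5)), valB0 _ _ _ h3]
        simp
      · rw [show I+I+3 = 2*I+3 by ring, ← mul_assoc (hw (2*I+3)), valB0 _ _ _ h2]
        simp
    · rw [valA0 _ _ h1, zero_mul]
  · rw [main_int, show I+I+J+J+5 = 2*I+2*J+5 by ring, ← mul_assoc (hw (2*I+2*J+5)), valB,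
      show I+I+3 = 2*I+3 by ring, ← mul_assoc (hw (2*I+3)), valB, valA]
    rw [div_mul_div_comm, div_mul_div_comm]
    push_cast
    congr 1
    · norm_num
    · ring
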